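/- Let d ≥ 2 and 0 < δ < a < b, and let X = X(A,a,b,δ) be an Engel set with R = √(b²+(d−1)a²). Then X is a regular system if and only if all of its 2dR-clusters are mutually equivalent, i.e., N_X(2dR) = 1. -/

import Mathlib

noncomputable section
open scoped Pointwise

/-- Euclidean d-space. -/
abbrev Euc (d : ℕ) : Type := EuclideanSpace ℝ (Fin d)

/-- The 1-based standard basis vector `e_k` of `ℝ^d` (for `1 ≤ k ≤ d`). -/
def eVec (d k : ℕ) : Euc d :=
  if h : k - 1 < d then EuclideanSpace.single ⟨k - 1, h⟩ (1 : ℝ) else 0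

/-- Conditions (A1)–(A3) on the doubly-infinite integer sequence `A`. -/
def EngelSeq (d : ℕ) (A : ℤ → ℤ) : Prop :=
  (∀ i : ℤ, 1 ≤ (A i).natAbs ∧ (A i).natAbs ≤ d - 1) ∧
  (∀ i : ℤ, (A (i + (d - 1))).natAbs = (A i).natAbs) ∧
  (∀ s : ℕ, 1 ≤ s → s ≤ d - 1 → ∃ i : ℤ, 1 ≤ i ∧ i ≤ d - 1 ∧ (A i).natAbs = s)

/-- The vector `u_i = sign(a_i) e_{|a_i|}`. -/
def engelU (d : ℕ) (A : ℤ → ℤ) (i : ℤ) : Euc d :=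
  (if 0 < A i then (1 : ℝ) else -1) • eVec d (A i).natAbs

/-- The cumulative sum `u_1 + ⋯ + u_i` (with the natural convention for `i ≤ 0`,
so that `engelCum 0 = 0` and `engelCum i - engelCum (i-1) = u_i` for all `i`). -/
def engelCum (d : ℕ) (A : ℤ → ℤ) (i : ℤ) : Euc d :=
  if 0 ≤ i then ∑ j ∈ Finset.range i.toNat, engelU d A ((j : ℤ) + 1)
  else -∑ j ∈ Finset.range (-i).toNat, engelU d A (-(j : ℤ))

/-- The translation vector placing layer `m` of an Engel set:
layer `m` lies at height `2bm`, and the horizontal shifts `δ·u_i` accumulate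
according to (E3), (E4). (Integer division is floor division.) -/
def engelOffset (d : ℕ) (A : ℤ → ℤ) (b δ : ℝ) (m : ℤ) : Euc d :=
  ((2 * b) * (m : ℝ)) • eVec d d + δ • engelCum d A (m / 2)

/-- The horizontal grid `Y = 2aℤ^{d-1} × {0}` in `ℝ^d`. -/
def engelGrid (d : ℕ) (a : ℝ) : Set (Euc d) :=
  {x | ∀ j : Fin d, ((j : ℕ) < d - 1 → ∃ m : ℤ, x j = 2 * a * (m : ℝ)) ∧
        ((j : ℕ) = d - 1 → x j = 0)}

/-- Layer `X_m` of the Engel set `X(A,a,b,δ)`. -/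
def engelLayer (d : ℕ) (A : ℤ → ℤ) (a b δ : ℝ) (m : ℤ) : Set (Euc d) :=
  engelOffset d A b δ m +ᵥ engelGrid d a

/-- The Engel set `X(A,a,b,δ) = ⋃_m X_m`. -/
def engelSet (d : ℕ) (A : ℤ → ℤ) (a b δ : ℝ) : Set (Euc d) :=
  ⋃ m : ℤ, engelLayer d A a b δ m

/-- A Delone set of type `(r,R)`: every open `r`-ball contains at most one point of `X`,
and every closed `R`-ball contains at least one point of `X`. -/
def IsDeloneSet {V : Type*} [MetricSpace V] (X : Set V) (r R : ℝ) : Prop :=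
  (∀ y : V, (X ∩ Metric.ball y r).Subsingleton) ∧
  (∀ y : V, (X ∩ Metric.closedBall y R).Nonempty)

/-- The ρ-cluster of `X` at `x`. -/
def cluster {V : Type*} [MetricSpace V] (X : Set V) (x : V) (ρ : ℝ) : Set V :=
  X ∩ Metric.closedBall x ρ

/-- Equivalence of the ρ-clusters of `X` at `x` and `x'`: an isometry of the ambient
space carries the one cluster onto the other, mapping center to center. -/
def ClustersEquiv {V : Type*} [MetricSpace V] (X : Set V) (x x' : V) (ρ : ℝ) : Prop :=
  ∃ g : V ≃ᵢ V, g x = x' ∧ g '' cluster X x ρ = cluster X x' ρ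

/-- A regular system: the symmetry group of `X` acts transitively on `X`. -/
def IsRegularSystem {V : Type*} [MetricSpace V] (X : Set V) : Prop :=
  ∀ x ∈ X, ∀ y ∈ X, ∃ g : V ≃ᵢ V, g '' X = X ∧ g x = y

section Helpers

variable {n : ℕ} {A : ℤ → ℤ} {a b δ : ℝ}

lemma eVec_last : eVec (n + 1) (n + 1) = EuclideanSpace.single (Fin.last n) (1 : ℝ) := by
  simp [eVec, Fin.last]

lemma engelU_eq (hA : EngelSeq (n + 1) A) (i : ℤ) :
    ∃ k : Fin n, (k : ℕ) + 1 = (A i).natAbs ∧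
      engelU (n + 1) A i =
        (if 0 < A i then (1 : ℝ) else -1) • EuclideanSpace.single k.castSucc (1 : ℝ) := by
  obtain ⟨h1, h2⟩ := hA.1 i
  have hk : (A i).natAbs - 1 < n := by omega
  refine ⟨⟨(A i).natAbs - 1, hk⟩, by simp; omega, ?_⟩
  have hk' : (A i).natAbs - 1 < n + 1 := by omega
  simp [engelU, eVec, hk']

lemma norm_engelU (hA : EngelSeq (n + 1) A) (i : ℤ) : ‖engelU (n + 1) A i‖ = 1 := by
  obtain ⟨k, -, h⟩ := engelU_eq hA i
  rw [h]
  split_ifs <;> simp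

lemma inner_engelU_eVec (hA : EngelSeq (n + 1) A) (i : ℤ) :
    inner ℝ (engelU (n + 1) A i) (eVec (n + 1) (n + 1)) = 0 := by
  obtain ⟨k, -, h⟩ := engelU_eq hA i
  rw [h, eVec_last, inner_smul_left]
  simp [EuclideanSpace.inner_single_left, (Fin.castSucc_lt_last k).ne]

lemma inner_engelU_of_ne (hA : EngelSeq (n + 1) A) {i j : ℤ}
    (hij : (A i).natAbs ≠ (A j).natAbs) :
    inner ℝ (engelU (n + 1) A i) (engelU (n + 1) A j) = 0 := by
  obtain ⟨k, hk, h⟩ := engelU_eq hA i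
  obtain ⟨l, hl, h'⟩ := engelU_eq hA j
  have hkl : k ≠ l := by
    rintro rfl
    exact hij (hk.symm.trans hl)
  rw [h, h', inner_smul_left, inner_smul_right]
  simp [EuclideanSpace.inner_single_left, hkl]

lemma natAbs_add_mul (hA : EngelSeq (n + 1) A) (i k : ℤ) :
    (A (i + n * k)).natAbs = (A i).natAbs := by
  have h : Function.Periodic (fun i => (A i).natAbs) (n : ℤ) := fun i => by
    have := hA.2.1 i
    simpa using this
  have := h.int_mul k i
  simpa [mul_comm] using this

/-- Within a period, the coordinate direction `|a_i|` determines the index. -/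
lemma dvd_sub_of_natAbs_eq (hA : EngelSeq (n + 1) A) {i j : ℤ}
    (hij : (A i).natAbs = (A j).natAbs) : (n : ℤ) ∣ i - j := by
  have hn : 0 < n := by
    have := hA.1 0
    omega
  let g : Fin n → Fin n := fun t => ⟨(A (1 + (t : ℕ))).natAbs - 1, by
    have := hA.1 (1 + (t : ℕ))
    omega⟩
  have hg : Function.Surjective g := by
    intro s
    obtain ⟨i, h1, h2, h3⟩ := hA.2.2 (s + 1) (by omega) (by simp)
    refine ⟨⟨(i - 1).toNat, by push_cast at h2; omega⟩, ?_⟩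
    have : (1 : ℤ) + ((i - 1).toNat : ℕ) = i := by omega
    apply Fin.ext
    simp only [g, this]
    omega
  have hinj := Finite.injective_iff_surjective.2 hg
  have key : ∀ i : ℤ, ∃ t : Fin n, (n : ℤ) ∣ i - (1 + (t : ℕ)) ∧
      (A i).natAbs = (A (1 + (t : ℕ))).natAbs := by
    intro i
    have h0 := Int.emod_nonneg (i - 1) (by omega : (n : ℤ) ≠ 0)
    have h1 := Int.emod_lt_of_pos (i - 1) (by omega : (0 : ℤ) < n)
    have h2 := Int.emod_add_mul_ediv (i - 1) n
    refine ⟨⟨((i - 1) % n).toNat, by omega⟩, ⟨(i - 1) / n, ?_⟩, ?_⟩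
    · simp only [Int.toNat_of_nonneg h0]
      linarith
    · simp only [Int.toNat_of_nonneg h0]
      rw [← natAbs_add_mul hA (1 + (i - 1) % n) ((i - 1) / n)]
      congr 2
      linarith
  obtain ⟨s, hs, hs'⟩ := key i
  obtain ⟨t, ht, ht'⟩ := key j
  have hst : s = t := hinj (Fin.ext (by simp only [g]; omega))
  subst hst
  have := dvd_sub hs ht
  simpa using this

/-- Reading `A` forwards (`θ = 1`) or backwards (`θ = -1`) from a given index yields `n`
shift vectors which, together with the vertical unit vector, form an orthonormal basis. -/
lemma exists_engelBasis (hA : EngelSeq (n + 1) A) (θ c : ℤ) (hθ : θ = 1 ∨ θ = -1) :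
    ∃ B : OrthonormalBasis (Fin (n + 1)) ℝ (Euc (n + 1)),
      (∀ t : Fin n, B t.castSucc = (θ : ℝ) • engelU (n + 1) A (θ * (t : ℕ) + c)) ∧
      B (Fin.last n) = (θ : ℝ) • eVec (n + 1) (n + 1) := by
  let v : Fin (n + 1) → Euc (n + 1) :=
    Fin.snoc (α := fun _ => Euc (n + 1))
      (fun t : Fin n => (θ : ℝ) • engelU (n + 1) A (θ * (t : ℕ) + c))
      ((θ : ℝ) • eVec (n + 1) (n + 1))
  have hθ' : |(θ : ℝ)| = 1 := by rcases hθ with rfl | rfl <;> simp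
  have hv : Orthonormal ℝ v := by
    constructor
    · intro t
      induction t using Fin.lastCases with
      | last => simp [v, norm_smul, hθ', eVec_last]
      | cast t => simp [v, norm_smul, hθ', norm_engelU hA]
    · intro s t hst
      induction s using Fin.lastCases with
      | last =>
        induction t using Fin.lastCases with
        | last => exact absurd rfl hst
        | cast t =>
          simp only [v, Fin.snoc_last, Fin.snoc_castSucc]
          rw [inner_smul_left, inner_smul_right, real_inner_comm, inner_engelU_eVec hA]
          simp
      | cast s =>
        induction t using Fin.lastCases with
        | last =>
          simp only [v, Fin.snoc_last, Fin.snoc_castSucc]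
          rw [inner_smul_left, inner_smul_right, inner_engelU_eVec hA]
          simp
        | cast t =>
          simp only [v, Fin.snoc_castSucc]
          rw [inner_smul_left, inner_smul_right, inner_engelU_of_ne hA]
          · simp
          · intro h
            apply hst
            have h1 := dvd_sub_of_natAbs_eq hA h
            have h2 : (n : ℤ) ∣ (s : ℕ) - (t : ℕ) := by
              rcases hθ with rfl | rfl
              · simpa using h1
              · rw [show ((s : ℕ) : ℤ) - (t : ℕ) =
                  -(-1 * (s : ℕ) + c - (-1 * (t : ℕ) + c)) by ring]
                exact (dvd_neg (α := ℤ)).2 h1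
            have h3 : ((s : ℕ) : ℤ) - (t : ℕ) = 0 :=
              Int.eq_zero_of_abs_lt_dvd h2 (by rw [abs_lt]; omega)
            congr 1
            exact Fin.ext (by omega)
  have hsp : Submodule.span ℝ (Set.range v) = ⊤ :=
    hv.linearIndependent.span_eq_top_of_card_eq_finrank' (by simp)
  refine ⟨OrthonormalBasis.mk hv hsp.ge, fun t => ?_, ?_⟩ <;> simp [v]

lemma engelU_add_period (hA : EngelSeq (n + 1) A) (i : ℤ) :
    engelU (n + 1) A (i + n) = engelU (n + 1) A i ∨
      engelU (n + 1) A (i + n) = -engelU (n + 1) A i := by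
  have h : (A (i + n)).natAbs = (A i).natAbs := by simpa using natAbs_add_mul hA i 1
  have h0 := (hA.1 i).1
  simp only [engelU, h]
  rcases Int.natAbs_eq_natAbs_iff.1 h with h | h
  · left
    rw [h]
  · right
    by_cases hp : 0 < A i
    · rw [if_neg (by omega), if_pos hp]
      simp
    · rw [if_pos (by omega), if_neg hp]
      simp

lemma engelCum_zero (d : ℕ) (A : ℤ → ℤ) : engelCum d A 0 = 0 := by
  simp [engelCum]

lemma engelCum_add_one (d : ℕ) (A : ℤ → ℤ) (i : ℤ) :
    engelCum d A (i + 1) = engelCum d A i + engelU d A (i + 1) := by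
  rcases lt_trichotomy i (-1) with h | rfl | h
  · have h1 : ¬ 0 ≤ i := by omega
    have h2 : ¬ 0 ≤ i + 1 := by omega
    have h3 : (-i).toNat = (-(i + 1)).toNat + 1 := by omega
    have h4 : -(((-(i + 1)).toNat : ℕ) : ℤ) = i + 1 := by omega
    simp only [engelCum, if_neg h1, if_neg h2, h3, Finset.sum_range_succ, h4]
    abel
  · simp [engelCum]
  · have h1 : 0 ≤ i := by omega
    have h2 : 0 ≤ i + 1 := by omega
    have h3 : (i + 1).toNat = i.toNat + 1 := by omega
    have h4 : ((i.toNat : ℕ) : ℤ) = i := by omega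
    simp only [engelCum, if_pos h1, if_pos h2, h3, Finset.sum_range_succ, h4]

lemma eq_of_sub_eq {E : Type*} [AddCommGroup E] {F G : ℤ → E} (h0 : F 0 = G 0)
    (h : ∀ i, F (i + 1) - F i = G (i + 1) - G i) (i : ℤ) : F i = G i := by
  induction i using Int.induction_on with
  | zero => exact h0
  | succ i ih =>
    have := h i
    rw [ih] at this
    simpa using this
  | pred i ih =>
    have := h (-(i : ℤ) - 1)
    rw [sub_add_cancel, ih] at this
    simpa using this

lemma engelCum_add_nat (d : ℕ) (A : ℤ → ℤ) (i : ℤ) (k : ℕ) :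
    engelCum d A (i + k) = engelCum d A i + ∑ t ∈ Finset.range k, engelU d A (i + 1 + (t : ℕ)) := by
  induction k with
  | zero => simp
  | succ k ih =>
    rw [Finset.sum_range_succ, ← add_assoc, ← ih, Nat.cast_succ, ← add_assoc, engelCum_add_one,
      add_right_comm i 1]

/-- The horizontal grid as a subgroup. -/
def gridSubgroup (n : ℕ) (a : ℝ) : AddSubgroup (Euc (n + 1)) where
  carrier := engelGrid (n + 1) a
  zero_mem' := fun j => ⟨fun _ => ⟨0, by simp⟩, fun _ => by simp⟩
  add_mem' := by
    intro x y hx hy j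
    refine ⟨fun h => ?_, fun h => ?_⟩
    · obtain ⟨p, hp⟩ := (hx j).1 h
      obtain ⟨q, hq⟩ := (hy j).1 h
      exact ⟨p + q, by simp [hp, hq]; ring⟩
    · simp [(hx j).2 h, (hy j).2 h]
  neg_mem' := by
    intro x hx j
    refine ⟨fun h => ?_, fun h => ?_⟩
    · obtain ⟨p, hp⟩ := (hx j).1 h
      exact ⟨-p, by simp [hp]⟩
    · simp [(hx j).2 h]

lemma mem_gridSubgroup {x : Euc (n + 1)} :
    x ∈ gridSubgroup n a ↔
      (∀ k : Fin n, ∃ m : ℤ, x k.castSucc = 2 * a * m) ∧ x (Fin.last n) = 0 := by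
  change x ∈ engelGrid (n + 1) a ↔ _
  constructor
  · intro h
    exact ⟨fun k => (h k.castSucc).1 (by simp), (h (Fin.last n)).2 (by simp)⟩
  · rintro ⟨h1, h2⟩ j
    induction j using Fin.lastCases with
    | last => exact ⟨fun h => by simp at h, fun _ => h2⟩
    | cast k => exact ⟨fun _ => h1 k, fun h => by simp at h; omega⟩

lemma mem_engelSet {x : Euc (n + 1)} :
    x ∈ engelSet (n + 1) A a b δ ↔
      ∃ m, ∃ y ∈ gridSubgroup n a, x = engelOffset (n + 1) A b δ m + y := by
  simp only [engelSet, engelLayer, Set.mem_iUnion, Set.mem_vadd_set, vadd_eq_add]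
  exact ⟨fun ⟨m, y, hy, h⟩ => ⟨m, y, hy, h.symm⟩, fun ⟨m, y, hy, h⟩ => ⟨m, y, hy, h.symm⟩⟩

lemma smul_engelU_mem (hA : EngelSeq (n + 1) A) (i : ℤ) :
    (2 * a) • engelU (n + 1) A i ∈ gridSubgroup n a := by
  obtain ⟨k, -, h⟩ := engelU_eq hA i
  have hmem : (2 * a) • EuclideanSpace.single k.castSucc (1 : ℝ) ∈ gridSubgroup n a := by
    rw [mem_gridSubgroup]
    refine ⟨fun l => ⟨if l = k then 1 else 0, ?_⟩, ?_⟩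
    · by_cases hl : l = k <;> simp [hl]
    · simp [(Fin.castSucc_lt_last k).ne']
  rw [h]
  split_ifs
  · simpa using hmem
  · simpa using neg_mem hmem

lemma gridSubgroup_le (hA : EngelSeq (n + 1) A) {H : AddSubgroup (Euc (n + 1))}
    (hH : ∀ i, (2 * a) • engelU (n + 1) A i ∈ H) : gridSubgroup n a ≤ H := by
  have hs : ∀ k : Fin n, (2 * a) • EuclideanSpace.single k.castSucc (1 : ℝ) ∈ H := by
    intro k
    obtain ⟨i, -, -, hi⟩ := hA.2.2 (k + 1) (by omega) (by simp)
    obtain ⟨l, hl, h⟩ := engelU_eq hA i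
    have hlk : l = k := Fin.ext (by omega)
    subst hlk
    have := hH i
    rw [h] at this
    split_ifs at this
    · simpa using this
    · simpa using neg_mem this
  intro x hx
  obtain ⟨h1, h2⟩ := mem_gridSubgroup.1 hx
  choose m hm using h1
  have : x = ∑ k : Fin n, m k • ((2 * a) • EuclideanSpace.single k.castSucc (1 : ℝ)) := by
    ext j
    induction j using Fin.lastCases with
    | last => simp [h2, (Fin.castSucc_lt_last _).ne']
    | cast k => simp [hm, Finset.sum_ite_eq, mul_comm, Pi.single_apply]
  rw [this]
  exact sum_mem fun k _ => zsmul_mem (hs k) _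

lemma exists_inner_engelU (hA : EngelSeq (n + 1) A) (i : ℤ) {y : Euc (n + 1)}
    (hy : y ∈ gridSubgroup n a) : ∃ m : ℤ, inner ℝ (engelU (n + 1) A i) y = 2 * a * m := by
  obtain ⟨k, -, h⟩ := engelU_eq hA i
  obtain ⟨m, hm⟩ := (mem_gridSubgroup.1 hy).1 k
  rw [h, inner_smul_left, EuclideanSpace.inner_single_left, hm]
  split_ifs
  · exact ⟨m, by simp⟩
  · exact ⟨-m, by simp⟩

lemma inner_eVec_last (y : Euc (n + 1)) :
    inner ℝ (eVec (n + 1) (n + 1)) y = y (Fin.last n) := by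
  simp [eVec_last, EuclideanSpace.inner_single_left]

lemma engelU_last (hA : EngelSeq (n + 1) A) (i : ℤ) :
    engelU (n + 1) A i (Fin.last n) = 0 := by
  rw [← inner_eVec_last, real_inner_comm, inner_engelU_eVec hA]

lemma engelCum_last (hA : EngelSeq (n + 1) A) (i : ℤ) :
    engelCum (n + 1) A i (Fin.last n) = 0 :=
  eq_of_sub_eq (F := fun i => engelCum (n + 1) A i (Fin.last n)) (G := fun _ => 0)
    (by simp [engelCum_zero]) (fun i => by simp [engelCum_add_one, engelU_last hA]) i

lemma engelOffset_last (hA : EngelSeq (n + 1) A) (m : ℤ) :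
    engelOffset (n + 1) A b δ m (Fin.last n) = 2 * b * m := by
  simp [engelOffset, engelCum_last hA, eVec_last]

/-! ### Symmetries of Engel sets with (anti)periodic shifts -/

section Symmetry

variable {s : ℝ} {θ : ℤ}

/-- If the shifts satisfy `u_{i+n} = s u_i` for a fixed `s`, then reading them forwards or
backwards from any index is realised by a linear isometry. -/
lemma exists_shift_isometry (hA : EngelSeq (n + 1) A)
    (hs : ∀ i, engelU (n + 1) A (i + n) = s • engelU (n + 1) A i)
    (hss : s = 1 ∨ s = -1) (c : ℤ) (hθ : θ = 1 ∨ θ = -1) :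
    ∃ L : Euc (n + 1) ≃ₗᵢ[ℝ] Euc (n + 1),
      (∀ i, L (engelU (n + 1) A i) = (θ : ℝ) • engelU (n + 1) A (θ * i + c)) ∧
      L (eVec (n + 1) (n + 1)) = (θ : ℝ) • eVec (n + 1) (n + 1) := by
  obtain ⟨B, hB, hBl⟩ := exists_engelBasis hA 1 0 (Or.inl rfl)
  obtain ⟨B', hB', hBl'⟩ := exists_engelBasis hA θ c hθ
  have hn : 0 < n := by
    have := hA.1 0
    omega
  have hs2 : s * s = 1 := by rcases hss with rfl | rfl <;> norm_num
  have hs' : ∀ i, engelU (n + 1) A (i - n) = s • engelU (n + 1) A i := by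
    intro i
    have := hs (i - n)
    rw [sub_add_cancel] at this
    rw [this, smul_smul, hs2, one_smul]
  let L := B.equiv B' (Equiv.refl _)
  have hL : ∀ t, L (B t) = B' t := fun t => by simp [L]
  have base : ∀ t : Fin n, L (engelU (n + 1) A (t : ℕ)) =
      (θ : ℝ) • engelU (n + 1) A (θ * (t : ℕ) + c) := by
    intro t
    have := hL t.castSucc
    rw [hB, hB'] at this
    simpa using this
  have step : ∀ i, L (engelU (n + 1) A i) = (θ : ℝ) • engelU (n + 1) A (θ * i + c) ↔
      L (engelU (n + 1) A (i + n)) = (θ : ℝ) • engelU (n + 1) A (θ * (i + n) + c) := by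
    intro i
    have h1 : engelU (n + 1) A (θ * (i + n) + c) = s • engelU (n + 1) A (θ * i + c) := by
      rcases hθ with rfl | rfl
      · rw [← hs]
        congr 1
        ring
      · rw [← hs']
        congr 1
        ring
    rw [h1, hs, map_smul, smul_comm (θ : ℝ) s]
    have hs0 : s ≠ 0 := by rintro rfl; simp at hs2
    exact (smul_right_injective _ hs0).eq_iff.symm
  have mul : ∀ k i : ℤ, L (engelU (n + 1) A i) = (θ : ℝ) • engelU (n + 1) A (θ * i + c) ↔
      L (engelU (n + 1) A (i + n * k)) =
        (θ : ℝ) • engelU (n + 1) A (θ * (i + n * k) + c) := by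
    intro k i
    induction k using Int.induction_on with
    | zero => simp
    | succ k ih =>
      rw [ih, step (i + n * k)]
      ring_nf
    | pred k ih =>
      rw [ih, step (i + n * (-k - 1))]
      ring_nf
  refine ⟨L, fun i => ?_, ?_⟩
  · have h0 := Int.emod_nonneg i (by omega : (n : ℤ) ≠ 0)
    have h1 := Int.emod_lt_of_pos i (by omega : (0 : ℤ) < n)
    have h2 := base ⟨(i % n).toNat, by omega⟩
    simp only [Int.toNat_of_nonneg h0] at h2
    rw [mul (i / n), Int.emod_add_mul_ediv] at h2
    exact h2
  · have := hL (Fin.last n)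
    rw [hBl, hBl'] at this
    simpa using this

lemma exists_symmetry_offset (hA : EngelSeq (n + 1) A)
    (hs : ∀ i, engelU (n + 1) A (i + n) = s • engelU (n + 1) A i)
    (hss : s = 1 ∨ s = -1) (m : ℤ) :
    ∃ g : Euc (n + 1) ≃ᵢ Euc (n + 1),
      g '' engelSet (n + 1) A a b δ = engelSet (n + 1) A a b δ ∧
      g 0 = engelOffset (n + 1) A b δ m := by
  obtain ⟨θ, c, hθ, hc, hm⟩ : ∃ θ c : ℤ, (θ = 1 ∨ θ = -1) ∧
      (∀ q, (θ = 1 → θ * (q + 1) + c = m / 2 + θ * q + 1) ∧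
        (θ = -1 → θ * (q + 1) + c = m / 2 + θ * q)) ∧
      ∀ p, (m + θ * p) / 2 = m / 2 + θ * (p / 2) := by
    rcases Int.even_or_odd' m with ⟨j, rfl | rfl⟩
    · exact ⟨1, j, Or.inl rfl, by omega, by omega⟩
    · exact ⟨-1, j + 1, Or.inr rfl, by omega, by omega⟩
  have hθ2 : θ * θ = 1 := by rcases hθ with rfl | rfl <;> norm_num
  obtain ⟨L, hLu, hLe⟩ := exists_shift_isometry hA hs hss c hθ
  have hcum : ∀ q, L (engelCum (n + 1) A q) =
      engelCum (n + 1) A (m / 2 + θ * q) - engelCum (n + 1) A (m / 2) := by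
    refine eq_of_sub_eq (by simp [engelCum_zero]) fun q => ?_
    rw [engelCum_add_one, map_add, hLu, add_sub_cancel_left, sub_sub_sub_cancel_right]
    rcases hθ with rfl | rfl
    · rw [(hc q).1 rfl, show m / 2 + 1 * (q + 1) = m / 2 + 1 * q + 1 by ring, engelCum_add_one]
      simp
    · rw [(hc q).2 rfl]
      have := engelCum_add_one (n + 1) A (m / 2 + -1 * (q + 1))
      rw [show m / 2 + -1 * (q + 1) + 1 = m / 2 + -1 * q by ring] at this
      rw [this]
      simp
  have hoff : ∀ p, engelOffset (n + 1) A b δ m + L (engelOffset (n + 1) A b δ p) =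
      engelOffset (n + 1) A b δ (m + θ * p) := by
    intro p
    simp only [engelOffset, map_add, map_smul, hLe, hcum, hm]
    push_cast
    module
  have hgrid : ∀ y ∈ gridSubgroup n a, L y ∈ gridSubgroup n a := by
    apply gridSubgroup_le hA (H := (gridSubgroup n a).comap (L : Euc (n + 1) →+ Euc (n + 1)))
    intro i
    change L ((2 * a) • engelU (n + 1) A i) ∈ gridSubgroup n a
    rw [map_smul, hLu]
    have := smul_engelU_mem (a := a) hA (θ * i + c)
    rcases hθ with rfl | rfl
    · simpa using this
    · simpa using neg_mem this
  have hgrid' : ∀ y ∈ gridSubgroup n a, L.symm y ∈ gridSubgroup n a := by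
    apply gridSubgroup_le hA (H := (gridSubgroup n a).comap
      ((L.symm : Euc (n + 1) ≃ₗᵢ[ℝ] Euc (n + 1)) : Euc (n + 1) →+ Euc (n + 1)))
    intro i
    change L.symm ((2 * a) • engelU (n + 1) A i) ∈ gridSubgroup n a
    have h1 := hLu (θ * (i - c))
    rw [← mul_assoc, hθ2, one_mul, sub_add_cancel] at h1
    have h2 : L.symm (engelU (n + 1) A i) = (θ : ℝ) • engelU (n + 1) A (θ * (i - c)) := by
      rw [LinearIsometryEquiv.symm_apply_eq, map_smul, h1, smul_smul]
      rw [← Int.cast_mul, hθ2]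
      simp
    rw [map_smul, h2]
    have := smul_engelU_mem (a := a) hA (θ * (i - c))
    rcases hθ with rfl | rfl
    · simpa using this
    · simpa using neg_mem this
  refine ⟨L.toIsometryEquiv.trans (IsometryEquiv.addLeft (engelOffset (n + 1) A b δ m)), ?_, ?_⟩
  · ext x
    simp only [Set.mem_image, IsometryEquiv.trans_apply, LinearIsometryEquiv.coe_toIsometryEquiv,
      IsometryEquiv.addLeft_apply]
    constructor
    · rintro ⟨y, hy, rfl⟩
      obtain ⟨p, z, hz, rfl⟩ := mem_engelSet.1 hy
      exact mem_engelSet.2 ⟨m + θ * p, L z, hgrid z hz, by rw [map_add, ← add_assoc, hoff]⟩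
    · intro hx
      obtain ⟨p, z, hz, rfl⟩ := mem_engelSet.1 hx
      refine ⟨_, mem_engelSet.2 ⟨θ * (p - m), L.symm z, hgrid' z hz, rfl⟩, ?_⟩
      rw [map_add, ← add_assoc, hoff, ← mul_assoc, hθ2]
      simp
  · simp

lemma isRegularSystem_of_period (hA : EngelSeq (n + 1) A)
    (hs : ∀ i, engelU (n + 1) A (i + n) = s • engelU (n + 1) A i)
    (hss : s = 1 ∨ s = -1) : IsRegularSystem (engelSet (n + 1) A a b δ) := by
  have key : ∀ x ∈ engelSet (n + 1) A a b δ, ∃ g : Euc (n + 1) ≃ᵢ Euc (n + 1),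
      g '' engelSet (n + 1) A a b δ = engelSet (n + 1) A a b δ ∧ g 0 = x := by
    intro x hx
    obtain ⟨m, y, hy, rfl⟩ := mem_engelSet.1 hx
    obtain ⟨g, hg, hg0⟩ := exists_symmetry_offset (a := a) (b := b) (δ := δ) hA hs hss m
    have htr : IsometryEquiv.addRight y '' engelSet (n + 1) A a b δ =
        engelSet (n + 1) A a b δ := by
      ext x
      simp only [Set.mem_image, IsometryEquiv.addRight_apply]
      constructor
      · rintro ⟨w, hw, rfl⟩
        obtain ⟨p, z, hz, rfl⟩ := mem_engelSet.1 hw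
        exact mem_engelSet.2 ⟨p, z + y, add_mem hz hy, add_assoc _ _ _⟩
      · intro hw
        obtain ⟨p, z, hz, rfl⟩ := mem_engelSet.1 hw
        exact ⟨_, mem_engelSet.2 ⟨p, z - y, sub_mem hz hy, rfl⟩, by abel⟩
    refine ⟨g.trans (IsometryEquiv.addRight y), ?_, by simp [hg0]⟩
    change (IsometryEquiv.addRight y ∘ g) '' _ = _
    rw [Set.image_comp, hg, htr]
  intro x hx y hy
  obtain ⟨g, hg, rfl⟩ := key x hx
  obtain ⟨h, hh, rfl⟩ := key y hy
  refine ⟨g.symm.trans h, ?_, by simp⟩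
  change (h ∘ g.symm) '' _ = _
  rw [Set.image_comp]
  nth_rw 1 [← hg]
  rw [← Set.image_comp g.symm, IsometryEquiv.symm_comp_self, Set.image_id, hh]

end Symmetry

/-! ### Equivalent clusters force the shifts to be (anti)periodic -/

lemma exists_grid_norm_le (ha : 0 < a) (v : Euc (n + 1)) :
    ∃ y ∈ gridSubgroup n a, ‖v + y‖ ^ 2 ≤ n * a ^ 2 + v (Fin.last n) ^ 2 := by
  let y : Euc (n + 1) := WithLp.toLp 2
    (Fin.snoc (α := fun _ => ℝ) (fun k : Fin n => 2 * a * (-round (v k.castSucc / (2 * a)) : ℤ)) 0)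
  refine ⟨y, mem_gridSubgroup.2 ⟨fun k => ⟨-round (v k.castSucc / (2 * a)), by simp [y]⟩,
    by simp [y]⟩, ?_⟩
  rw [EuclideanSpace.norm_sq_eq, Fin.sum_univ_castSucc]
  have h1 : ∀ k : Fin n, ‖(v + y) k.castSucc‖ ^ 2 ≤ a ^ 2 := by
    intro k
    have h := abs_sub_round (v k.castSucc / (2 * a))
    have h2 : (v + y) k.castSucc =
        2 * a * (v k.castSucc / (2 * a) - round (v k.castSucc / (2 * a))) := by
      simp only [y, PiLp.add_apply, Fin.snoc_castSucc]
      push_cast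
      field_simp
      ring
    rw [h2, norm_mul, Real.norm_eq_abs, Real.norm_eq_abs, abs_of_pos (by positivity : 0 < 2 * a)]
    have h3 : 2 * a * |v k.castSucc / (2 * a) - round (v k.castSucc / (2 * a))| ≤ a := by
      nlinarith
    exact pow_le_pow_left₀ (by positivity) h3 2
  refine add_le_add ((Finset.sum_le_sum fun k _ => h1 k).trans (by simp)) ?_
  simp [y]

lemma mem_of_cluster_isometry (hA : EngelSeq (n + 1) A) (hδ : 0 < δ) (hδa : δ < a) (hab : a < b)
    {ρ : ℝ} (hρ : 2 * a ≤ ρ) {p q : ℤ} (L : Euc (n + 1) ≃ₗᵢ[ℝ] Euc (n + 1))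
    (hL : ∀ v, ‖v‖ ≤ ρ → engelOffset (n + 1) A b δ p + v ∈ engelSet (n + 1) A a b δ →
      engelOffset (n + 1) A b δ q + L v ∈ engelSet (n + 1) A a b δ) :
    ∀ y ∈ gridSubgroup n a, L y ∈ gridSubgroup n a := by
  have ha := hδ.trans hδa
  apply gridSubgroup_le hA (H := (gridSubgroup n a).comap (L : Euc (n + 1) →+ Euc (n + 1)))
  intro i
  change L ((2 * a) • engelU (n + 1) A i) ∈ gridSubgroup n a
  have hnorm : ‖(2 * a) • engelU (n + 1) A i‖ = 2 * a := by
    rw [norm_smul, norm_engelU hA, Real.norm_of_nonneg (by positivity), mul_one]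
  obtain ⟨m, y, hy, h⟩ := mem_engelSet.1 (hL _ (hnorm.le.trans hρ)
    (mem_engelSet.2 ⟨p, _, smul_engelU_mem hA i, rfl⟩))
  have hlast := congrArg (fun v : Euc (n + 1) => v (Fin.last n)) h
  simp only [PiLp.add_apply, engelOffset_last hA, (mem_gridSubgroup.1 hy).2] at hlast
  have hle := PiLp.norm_apply_le (L ((2 * a) • engelU (n + 1) A i)) (Fin.last n)
  rw [LinearIsometryEquiv.norm_map, hnorm, Real.norm_eq_abs,
    show (L ((2 * a) • engelU (n + 1) A i)) (Fin.last n) = 2 * b * ((m - q : ℤ) : ℝ) by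
      push_cast; linarith, abs_mul, abs_of_pos (by linarith : 0 < 2 * b)] at hle
  have hmq : m = q := by
    by_contra hne
    have h1 : (1 : ℝ) ≤ |((m - q : ℤ) : ℝ)| := by
      rw [← Int.cast_abs]
      exact_mod_cast Int.one_le_abs (sub_ne_zero.2 hne)
    nlinarith
  subst hmq
  rwa [add_left_cancel h]

lemma eVec_map_of_grid (hA : EngelSeq (n + 1) A) (ha : 0 < a)
    (L : Euc (n + 1) ≃ₗᵢ[ℝ] Euc (n + 1))
    (hL : ∀ y ∈ gridSubgroup n a, L.symm y ∈ gridSubgroup n a) :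
    ∃ ε : ℤ, (ε = 1 ∨ ε = -1) ∧
      L (eVec (n + 1) (n + 1)) = (ε : ℝ) • eVec (n + 1) (n + 1) := by
  set E := eVec (n + 1) (n + 1) with hE
  obtain ⟨B, hB, hBl⟩ := exists_engelBasis hA 1 0 (Or.inl rfl)
  have hperp : ∀ i, inner ℝ (engelU (n + 1) A i) (L E) = 0 := by
    intro i
    have h1 := (mem_gridSubgroup.1 (hL _ (smul_engelU_mem hA i))).2
    rw [← inner_eVec_last, ← hE, ← LinearIsometryEquiv.inner_map_map L,
      LinearIsometryEquiv.apply_symm_apply, inner_smul_right, real_inner_comm] at h1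
    rcases mul_eq_zero.1 h1 with h | h
    · linarith
    · exact h
  have h1 : L E = inner ℝ E (L E) • E := by
    conv_lhs => rw [← B.sum_repr' (L E), Fin.sum_univ_castSucc]
    simp [hB, hBl, hperp, ← hE]
  have hE1 : ‖E‖ = 1 := by simp [hE, eVec_last]
  have h2 : |(inner ℝ E (L E) : ℝ)| = 1 := by
    have := congrArg norm h1
    rw [norm_smul, LinearIsometryEquiv.norm_map, hE1, Real.norm_eq_abs, mul_one] at this
    exact this.symm
  rcases (abs_eq zero_le_one).1 h2 with h | h
  · exact ⟨1, Or.inl rfl, by rw [h1, h]; simp⟩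
  · exact ⟨-1, Or.inr rfl, by rw [h1, h]; simp⟩

lemma cluster_offset_map (hA : EngelSeq (n + 1) A) (hδ : 0 < δ) (hδa : δ < a) (hab : a < b)
    {ρ : ℝ} (hρ0 : 0 ≤ ρ) {k p q : ℤ} (hρ : n * a ^ 2 + (2 * b * k) ^ 2 ≤ ρ ^ 2)
    (L : Euc (n + 1) ≃ₗᵢ[ℝ] Euc (n + 1))
    (hL : ∀ v, ‖v‖ ≤ ρ → engelOffset (n + 1) A b δ p + v ∈ engelSet (n + 1) A a b δ →
      engelOffset (n + 1) A b δ q + L v ∈ engelSet (n + 1) A a b δ)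
    (hgrid : ∀ y ∈ gridSubgroup n a, L y ∈ gridSubgroup n a) {ε : ℤ} (hε : ε = 1 ∨ ε = -1)
    (hLE : L (eVec (n + 1) (n + 1)) = (ε : ℝ) • eVec (n + 1) (n + 1)) :
    ∃ y ∈ gridSubgroup n a,
      L (engelOffset (n + 1) A b δ (p + k) - engelOffset (n + 1) A b δ p) =
        engelOffset (n + 1) A b δ (q + ε * k) - engelOffset (n + 1) A b δ q + y := by
  have ha := hδ.trans hδa
  have hε2 : (ε : ℝ) * ε = 1 := by rcases hε with rfl | rfl <;> norm_num
  set v := engelOffset (n + 1) A b δ (p + k) - engelOffset (n + 1) A b δ p with hv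
  have hvl : v (Fin.last n) = 2 * b * k := by
    simp only [hv, PiLp.sub_apply, engelOffset_last hA]
    push_cast
    ring
  have hheight : ∀ w, (L w) (Fin.last n) = ε * w (Fin.last n) := by
    intro w
    rw [← inner_eVec_last w, ← LinearIsometryEquiv.inner_map_map L, hLE, inner_smul_left,
      inner_eVec_last]
    simp only [conj_trivial]
    rw [← mul_assoc, hε2, one_mul]
  obtain ⟨y, hy, hle⟩ := exists_grid_norm_le ha v
  rw [hvl] at hle
  obtain ⟨m, z, hz, h⟩ := mem_engelSet.1 (hL (v + y)
    (abs_le_of_sq_le_sq' (hle.trans hρ) hρ0).2 (mem_engelSet.2 ⟨p + k, y, hy, by rw [hv]; abel⟩))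
  have hlast := congrArg (fun v : Euc (n + 1) => v (Fin.last n)) h
  simp only [PiLp.add_apply, engelOffset_last hA, (mem_gridSubgroup.1 hz).2, hheight, hvl,
    (mem_gridSubgroup.1 hy).2] at hlast
  have hm : m = q + ε * k := by
    have : 2 * b * ((q + ε * k : ℤ) : ℝ) = 2 * b * (m : ℝ) := by
      push_cast
      linarith
    exact_mod_cast (mul_left_cancel₀ (by linarith) this).symm
  subst hm
  refine ⟨z - L y, sub_mem hz (hgrid y hy), ?_⟩
  rw [map_add] at h
  rw [add_sub_assoc', eq_sub_iff_add_eq, sub_add_eq_add_sub, ← h]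
  abel

/-- A difference of offsets spanning `n + 1` consecutive shifts. -/
lemma engelOffset_sub_eq (i : ℤ) (n : ℕ) :
    engelOffset (n + 1) A b δ (2 * (i + n)) - engelOffset (n + 1) A b δ (2 * i - 1) =
      (2 * b * (2 * n + 1)) • eVec (n + 1) (n + 1) +
        δ • ((∑ t ∈ Finset.range n, engelU (n + 1) A (i + (t : ℕ))) +
          engelU (n + 1) A (i + n)) := by
  have h1 : 2 * (i + n) / 2 = (i - 1) + ((n + 1 : ℕ) : ℤ) := by omega
  have h2 : (2 * i - 1) / 2 = i - 1 := by omega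
  simp only [engelOffset, h1, h2, engelCum_add_nat, Finset.sum_range_succ, sub_add_cancel]
  push_cast
  module

lemma norm_sq_window (hA : EngelSeq (n + 1) A) (i : ℤ) (c H : ℝ) (y : Euc (n + 1)) :
    ‖H • eVec (n + 1) (n + 1) + δ • ((∑ t ∈ Finset.range n, engelU (n + 1) A (i + (t : ℕ))) +
        c • engelU (n + 1) A i) + y‖ ^ 2 =
      (∑ t : Fin n, (δ * (1 + if (t : ℕ) = 0 then c else 0) +
        inner ℝ (engelU (n + 1) A (i + (t : ℕ))) y) ^ 2) + (H + y (Fin.last n)) ^ 2 := by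
  obtain ⟨B, hB, hBl⟩ := exists_engelBasis hA 1 i (Or.inl rfl)
  have hn : 0 < n := by
    have := hA.1 0
    omega
  have hB' : ∀ t : Fin n, engelU (n + 1) A (i + (t : ℕ)) = B t.castSucc := by
    intro t
    rw [hB]
    simp [add_comm]
  have hE : eVec (n + 1) (n + 1) = B (Fin.last n) := by simp [hBl]
  have h0 : engelU (n + 1) A i = B (Fin.castSucc ⟨0, hn⟩) := by
    rw [← hB']
    simp
  have hlast : y (Fin.last n) = inner ℝ (B (Fin.last n)) y := by rw [← hE, inner_eVec_last]
  rw [Finset.sum_range, h0, hE, hlast]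
  simp only [hB']
  rw [← B.sum_sq_norm_inner_right, Fin.sum_univ_castSucc]
  congr 1
  · refine Finset.sum_congr rfl fun t _ => ?_
    simp only [inner_add_right, inner_smul_right, inner_sum, B.inner_eq_ite, Fin.castSucc_inj,
      (Fin.castSucc_lt_last t).ne, Fin.ext_iff (a := t), Real.norm_eq_abs, sq_abs]
    simp [← Fin.ext_iff]
  · simp [inner_add_right, inner_smul_right, inner_sum, B.inner_eq_ite,
      (Fin.castSucc_lt_last _).ne', hn.ne']

/-- The lengths of the offset differences, modulo the grid, detect the relative sign of
shifts that are one period apart. -/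
lemma engelU_period_of_norm_eq (hA : EngelSeq (n + 1) A) (hδ : 0 < δ) (hδa : δ < a) {i j : ℤ}
    {y : Euc (n + 1)} (hy : y ∈ gridSubgroup n a)
    (h : ‖engelOffset (n + 1) A b δ (2 * (j + n)) - engelOffset (n + 1) A b δ (2 * j - 1)‖ =
      ‖engelOffset (n + 1) A b δ (2 * (i + n)) - engelOffset (n + 1) A b δ (2 * i - 1) + y‖)
    (hi : engelU (n + 1) A (i + n) = engelU (n + 1) A i) :
    engelU (n + 1) A (j + n) = engelU (n + 1) A j := by
  refine (engelU_add_period hA j).resolve_right fun hj => ?_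
  have hn : 0 < n := by
    have := hA.1 0
    omega
  have ha := hδ.trans hδa
  have h1 := norm_sq_window (δ := δ) hA j (-1) (2 * b * (2 * n + 1)) 0
  have h2 := norm_sq_window (δ := δ) hA i 1 (2 * b * (2 * n + 1)) y
  rw [neg_one_smul, ← hj, ← engelOffset_sub_eq, add_zero, h] at h1
  rw [one_smul, ← hi, ← engelOffset_sub_eq, h1, (mem_gridSubgroup.1 hy).2] at h2
  simp only [inner_zero_right, add_zero, PiLp.zero_apply] at h2
  refine (add_right_cancel h2).not_lt (Finset.sum_lt_sum (fun t _ => ?_)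
    ⟨⟨0, hn⟩, Finset.mem_univ _, ?_⟩)
  · obtain ⟨m, hm⟩ := exists_inner_engelU hA (i + (t : ℕ)) hy
    rw [hm]
    split_ifs
    · nlinarith [sq_nonneg (δ * (1 + 1) + 2 * a * m)]
    · have hm' : 0 ≤ (m : ℝ) * (a * m + δ) := by
        rcases lt_trichotomy m 0 with hm0 | rfl | hm0
        · have : (m : ℝ) ≤ -1 := by exact_mod_cast (by omega : m ≤ -1)
          exact mul_nonneg_of_nonpos_of_nonpos (by linarith) (by nlinarith)
        · simp
        · have : (1 : ℝ) ≤ m := by exact_mod_cast hm0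
          positivity
      nlinarith [mul_nonneg ha.le hm']
  · obtain ⟨m, hm⟩ := exists_inner_engelU hA (i + (0 : ℕ)) hy
    simp only [hm, if_true]
    have hne : δ * (1 + 1) + 2 * a * m ≠ 0 := by
      intro h0
      have h3 : a * ((-m : ℤ) : ℝ) = δ := by
        push_cast
        linarith
      have h4 : (0 : ℝ) < ((-m : ℤ) : ℝ) := by
        by_contra hle
        nlinarith
      have h5 : (1 : ℝ) ≤ ((-m : ℤ) : ℝ) := by exact_mod_cast Int.cast_pos.1 h4
      nlinarith
    have := pow_pos (abs_pos.2 hne) 2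
    rw [sq_abs] at this
    simpa using this

lemma engelOffset_mem (m : ℤ) :
    engelOffset (n + 1) A b δ m ∈ engelSet (n + 1) A a b δ :=
  mem_engelSet.2 ⟨m, 0, zero_mem _, by simp⟩

lemma ClustersEquiv.exists_linearIsometryEquiv {E : Type*} [NormedAddCommGroup E]
    [NormedSpace ℝ E] {X : Set E} {x x' : E} {ρ : ℝ} (h : ClustersEquiv X x x' ρ) :
    ∃ L : E ≃ₗᵢ[ℝ] E, (∀ v, ‖v‖ ≤ ρ → x + v ∈ X → x' + L v ∈ X) ∧
      ∀ v, ‖v‖ ≤ ρ → x' + v ∈ X → x + L.symm v ∈ X := by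
  obtain ⟨g, hg, hX⟩ := h
  let G := g.toRealAffineIsometryEquiv
  have hG : ∀ v, g (x + v) = x' + G.linearIsometryEquiv v := by
    intro v
    have := G.map_vadd x v
    simp only [G, vadd_eq_add, IsometryEquiv.coeFn_toRealAffineIsometryEquiv, hg] at this
    rw [add_comm x v, this, add_comm]
  refine ⟨G.linearIsometryEquiv, fun v hv hmem => ?_, fun v hv hmem => ?_⟩
  · rw [← hG]
    have : g (x + v) ∈ cluster X x' ρ := by
      rw [← hX]
      exact ⟨_, ⟨hmem, by simpa using hv⟩, rfl⟩
    exact this.1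
  · have hmem' : x' + v ∈ g '' cluster X x ρ := by
      rw [hX]
      exact ⟨hmem, by simpa using hv⟩
    obtain ⟨w, hw, hwv⟩ := hmem'
    have h2 := hG (G.linearIsometryEquiv.symm v)
    rw [LinearIsometryEquiv.apply_symm_apply, ← hwv] at h2
    rw [g.injective h2]
    exact hw.1

lemma engelU_period_of_clustersEquiv (hA : EngelSeq (n + 1) A) (hδ : 0 < δ) (hδa : δ < a)
    (hab : a < b) {ρ : ℝ} (hρ0 : 2 * a ≤ ρ)
    (hρ : n * a ^ 2 + (2 * b * (n + 1)) ^ 2 ≤ ρ ^ 2) {i j : ℤ}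
    (h : ClustersEquiv (engelSet (n + 1) A a b δ) (engelOffset (n + 1) A b δ (2 * i))
      (engelOffset (n + 1) A b δ (2 * j)) ρ)
    (hi : engelU (n + 1) A (i - (n / 2 : ℕ) + n) = engelU (n + 1) A (i - (n / 2 : ℕ))) :
    engelU (n + 1) A (j - (n / 2 : ℕ) + n) = engelU (n + 1) A (j - (n / 2 : ℕ)) := by
  have ha := hδ.trans hδa
  obtain ⟨L, hL, hL'⟩ := h.exists_linearIsometryEquiv
  have hgrid := mem_of_cluster_isometry hA hδ hδa hab hρ0 L hL
  have hgrid' := mem_of_cluster_isometry hA hδ hδa hab hρ0 L.symm hL'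
  obtain ⟨ε, hε, hLE⟩ := eVec_map_of_grid hA ha L hgrid'
  have hmap : ∀ k : ℤ, |k| ≤ n + 1 → ∃ y ∈ gridSubgroup n a,
      L (engelOffset (n + 1) A b δ (2 * i + k) - engelOffset (n + 1) A b δ (2 * i)) =
        engelOffset (n + 1) A b δ (2 * j + ε * k) - engelOffset (n + 1) A b δ (2 * j) + y := by
    intro k hk
    refine cluster_offset_map hA hδ hδa hab (by linarith) (le_trans ?_ hρ) L hL hgrid hε hLE
    have hk' : |(k : ℝ)| ≤ n + 1 := by exact_mod_cast hk
    rw [mul_pow (2 * b), mul_pow (2 * b), ← sq_abs (k : ℝ)]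
    gcongr
  have hε1 : ε = 1 := by
    refine hε.resolve_right ?_
    rintro rfl
    obtain ⟨y, hy, h1⟩ := hmap 1 (by simp)
    have h2 : (2 * i + 1) / 2 = i := by omega
    have h3 : (2 * j + -1 * 1) / 2 = j - 1 := by omega
    have h4 : engelCum (n + 1) A j = engelCum (n + 1) A (j - 1) + engelU (n + 1) A j := by
      have := engelCum_add_one (n + 1) A (j - 1)
      rwa [sub_add_cancel] at this
    have h5 : y = δ • engelU (n + 1) A j := by
      simp only [engelOffset, h2, h3, Int.mul_ediv_cancel_left _ (two_ne_zero), h4,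
        add_sub_add_right_eq_sub, ← sub_smul, map_smul, hLE] at h1
      rw [← sub_eq_iff_eq_add'] at h1
      rw [← h1]
      push_cast
      module
    obtain ⟨m, hm⟩ := exists_inner_engelU hA j hy
    rw [h5, inner_smul_right, real_inner_self_eq_norm_sq, norm_engelU hA] at hm
    have h6 : (0 : ℝ) < m := by
      by_contra hle
      nlinarith
    have h7 : (1 : ℝ) ≤ m := by exact_mod_cast Int.cast_pos.1 h6
    nlinarith
  subst hε1
  obtain ⟨y, hy, h1⟩ := hmap (2 * ((n : ℤ) - (n / 2 : ℕ))) (by rw [abs_le]; omega)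
  obtain ⟨z, hz, h2⟩ := hmap (-(2 * (n / 2 : ℕ) + 1)) (by rw [abs_le]; omega)
  have e1 : ∀ i : ℤ, 2 * i + 2 * ((n : ℤ) - (n / 2 : ℕ)) = 2 * (i - (n / 2 : ℕ) + n) := by
    intro i
    ring
  have e2 : ∀ i : ℤ, 2 * i + -(2 * (n / 2 : ℕ) + 1) = 2 * (i - (n / 2 : ℕ)) - 1 := by
    intro i
    ring
  rw [one_mul, e1, e1] at h1
  rw [one_mul, e2, e2] at h2
  have h3 := congrArg₂ (· - ·) h1 h2
  simp only [← map_sub, sub_sub_sub_cancel_right] at h3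
  refine engelU_period_of_norm_eq (b := b) hA hδ hδa (hgrid' _ (sub_mem hz hy)) ?_ hi
  rw [← LinearIsometryEquiv.norm_map L (_ + _), map_add, LinearIsometryEquiv.apply_symm_apply, h3]
  congr 1
  abel

end Helpers

/-- Theorem 5.9: for `d ≥ 2` and `0 < δ < a < b`, an Engel set
`X(A,a,b,δ)` with `R = √(b² + (d-1)a²)` is a regular system if and only if all of its
`2dR`-clusters are mutually equivalent, i.e. `N_X(2dR) = 1`. -/
theorem engelSet_regular_iff_clusters (d : ℕ) (hd : 2 ≤ d) (A : ℤ → ℤ)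
    (hA : EngelSeq d A) (a b δ : ℝ) (hδ : 0 < δ) (hδa : δ < a) (hab : a < b)
    (R : ℝ) (hR : R = Real.sqrt (b ^ 2 + ((d : ℝ) - 1) * a ^ 2)) :
    IsRegularSystem (engelSet d A a b δ) ↔
      (∀ x ∈ engelSet d A a b δ, ∀ x' ∈ engelSet d A a b δ,
        ClustersEquiv (engelSet d A a b δ) x x' (2 * (d : ℝ) * R)) := by
  obtain ⟨n, rfl⟩ : ∃ n, d = n + 1 := ⟨d - 1, by omega⟩
  constructor
  · intro h x hx x' hx'
    obtain ⟨g, hg, hgx⟩ := h x hx x' hx'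
    refine ⟨g, hgx, ?_⟩
    rw [cluster, Set.image_inter g.injective, hg, IsometryEquiv.image_closedBall, hgx, cluster]
  · intro h
    have ha := hδ.trans hδa
    have hb := ha.trans hab
    have hR2 : R ^ 2 = b ^ 2 + n * a ^ 2 := by
      rw [hR, Real.sq_sqrt] <;> push_cast <;> rw [add_sub_cancel_right]
      positivity
    have hR0 : 0 ≤ R := hR ▸ Real.sqrt_nonneg _
    have hRb : b ≤ R := by
      refine abs_le_of_sq_le_sq' ?_ hR0 |>.2
      rw [hR2]
      exact le_add_of_nonneg_right (by positivity)
    have hρ0 : 2 * a ≤ 2 * ((n + 1 : ℕ) : ℝ) * R := by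
      push_cast
      nlinarith [mul_nonneg (Nat.cast_nonneg (α := ℝ) n) hR0]
    have hρ : n * a ^ 2 + (2 * b * (n + 1)) ^ 2 ≤ (2 * ((n + 1 : ℕ) : ℝ) * R) ^ 2 := by
      rw [mul_pow _ R, hR2]
      push_cast
      have h1 : (1 : ℝ) ≤ (2 * (n + 1)) ^ 2 := by
        nlinarith [Nat.cast_nonneg (α := ℝ) n]
      nlinarith [mul_le_mul_of_nonneg_right h1 (by positivity : 0 ≤ n * a ^ 2)]
    have key : ∀ i j : ℤ, engelU (n + 1) A (i + n) = engelU (n + 1) A i →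
        engelU (n + 1) A (j + n) = engelU (n + 1) A j := by
      intro i j hi
      have := engelU_period_of_clustersEquiv (i := i + (n / 2 : ℕ)) (j := j + (n / 2 : ℕ)) hA hδ
        hδa hab hρ0 hρ (h _ (engelOffset_mem _) _ (engelOffset_mem _))
      simp only [add_sub_cancel_right] at this
      exact this hi
    by_cases h0 : engelU (n + 1) A (0 + n) = engelU (n + 1) A 0
    · exact isRegularSystem_of_period (s := 1) hA (fun i => by simpa using key 0 i h0)
        (Or.inl rfl)
    · exact isRegularSystem_of_period (s := -1) hA
        (fun i => by
          simpa using (engelU_add_period hA i).resolve_left fun hi => h0 (key i 0 hi))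
        (Or.inr rfl)
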